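/- For the Križ model of CP^1, the differential d: E_1^1(CP^1,n) → E_0^2(CP^1,n) is injective for n = 2 and n = 3, while for n ≥ 4 its kernel H_1^1 is nonzero of dimension n(n−3)/2 (it is the irreducible S_n-module V(n−2,2)). -/

import Mathlib

universe v

/-- The ordered product of the exterior generators of a canonical monomial. -/
def krizGprod {n : ℕ} {E : Type v} [Ring E] (G : Fin n → Fin n → E)
    (e : Fin n → Option (Fin n)) : E :=
  ((List.finRange n).filterMap fun j => (e j).map fun i => G i j).prod

/-- The Križ model `E(ℂP¹,n)` of the complex projective line (`A = ℚ[w]/(w²)`, `deg w = 2`,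
`m = 1`): a bigraded graded-commutative `ℚ`-algebra with classes `w i = p_i^*(w)`, exterior
generators `G_{ij}` of bidegree `(1,1)`, the Križ relations, the differential `d` with
`d(G_{ij}) = p_i^*(w) + p_j^*(w)`, the `S_n`-action, and the canonical basis. -/
structure KrizCP1 (n : ℕ) (E : Type v) [Ring E] [Algebra ℚ E] where
  /-- the bigrading: `comp q k` has exterior degree `q` and total degree `k` -/
  comp : ℕ → ℕ → Submodule ℚ E
  internal : DirectSum.IsInternal fun qk : ℕ × ℕ => comp qk.1 qk.2
  one_mem : (1 : E) ∈ comp 0 0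
  mul_mem : ∀ {q k q' k'} {a b : E}, a ∈ comp q k → b ∈ comp q' k' →
    a * b ∈ comp (q + q') (k + k')
  gcomm : ∀ {q k q' k'} {a b : E}, a ∈ comp q k → b ∈ comp q' k' →
    a * b = ((-1 : ℚ) ^ (k * k')) • (b * a)
  /-- the classes `w i = p_i^*(w)` -/
  w : Fin n → E
  w_mem : ∀ i, w i ∈ comp 0 2
  w_sq : ∀ i, w i * w i = 0
  /-- the exterior generators -/
  G : Fin n → Fin n → E
  G_symm : ∀ i j, G i j = G j i
  G_mem : ∀ {i j : Fin n}, i ≠ j → G i j ∈ comp 1 1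
  /-- the relation `p_j^*(w)G_{ij} = p_i^*(w)G_{ij}` -/
  rel_p : ∀ {i j : Fin n}, i ≠ j → w j * G i j = w i * G i j
  /-- the relation `G_{ik}G_{jk} = G_{ij}G_{jk} - G_{ij}G_{ik}` for `i < j < k` -/
  rel_G : ∀ {i j k : Fin n}, i < j → j < k →
    G i k * G j k = G i j * G j k - G i j * G i k
  /-- the differential -/
  d : E →ₗ[ℚ] E
  d_mem : ∀ {q k : ℕ} {a : E}, a ∈ comp (q + 1) k → d a ∈ comp q (k + 1)
  d_zero : ∀ {k : ℕ} {a : E}, a ∈ comp 0 k → d a = 0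
  d_w : ∀ i, d (w i) = 0
  d_G : ∀ {i j : Fin n}, i ≠ j → d (G i j) = w i + w j
  d_d : ∀ x : E, d (d x) = 0
  leibniz : ∀ {q k : ℕ} {a : E}, a ∈ comp q k → ∀ b : E,
    d (a * b) = d a * b + ((-1 : ℚ) ^ k) • (a * d b)
  /-- the `S_n`-action -/
  act : Equiv.Perm (Fin n) →* (E ≃ₐ[ℚ] E)
  act_w : ∀ (σ : Equiv.Perm (Fin n)) (i : Fin n), act σ (w i) = w (σ i)
  act_G : ∀ (σ : Equiv.Perm (Fin n)) (i j : Fin n), act σ (G i j) = G (σ i) (σ j)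
  act_comp : ∀ (σ : Equiv.Perm (Fin n)) (q k : ℕ) (x : E), x ∈ comp q k → act σ x ∈ comp q k
  /-- the canonical monomials `(∏_{i ∈ T} w i)·G_{I_*J_*}` (with `T ∩ J_* = ∅`) span `E` -/
  span_canon : Submodule.span ℚ
    {x : E | ∃ (T : Finset (Fin n)) (e : Fin n → Option (Fin n)),
      (∀ j i, e j = some i → i < j) ∧ (∀ j, e j ≠ none → j ∉ T) ∧
      x = (List.ofFn fun i => if i ∈ T then w i else 1).prod * krizGprod G e} = ⊤
  /-- the canonical monomials are linearly independent -/
  indep_canon : LinearIndependent ℚ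
    (fun c : {Te : Finset (Fin n) × (Fin n → Option (Fin n)) //
        (∀ j i, Te.2 j = some i → i < j) ∧ (∀ j, Te.2 j ≠ none → j ∉ Te.1)} =>
      (List.ofFn fun i => if i ∈ c.1.1 then w i else 1).prod * krizGprod G c.1.2)

namespace KrizCP1

variable {n : ℕ} {E : Type v} [Ring E] [Algebra ℚ E]

/-- The cocycles in bidegree `(k, q)`. -/
def cocycles (K : KrizCP1 n E) (q k : ℕ) : Submodule ℚ E :=
  K.comp q k ⊓ LinearMap.ker K.d

/-- The coboundaries in bidegree `(k, q)`. -/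
def boundaries (K : KrizCP1 n E) (q k : ℕ) : Submodule ℚ E :=
  Submodule.map K.d (K.comp (q + 1) (k - 1))

/-- The bidegree-`(k, q)` cohomology `H_q^k` of the Križ model of `ℂP¹`; by Križ's theorem
this is the rational cohomology of the configuration space `F(ℂP¹, n)`. -/
abbrev H (K : KrizCP1 n E) (q k : ℕ) :=
  ↥(K.cocycles q k) ⧸ (Submodule.comap (K.cocycles q k).subtype (K.boundaries q k))

end KrizCP1

section Combinatorics

variable {ι : Type*}

/-- The exchange matrix supported on the four-cycle `i k j l`. -/
def exchangeMatrix [DecidableEq ι] (i j k l : ι) (p q : ι) : ℚ :=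
  (Pi.single i 1 - Pi.single j 1 : ι → ℚ) p * (Pi.single k 1 - Pi.single l 1 : ι → ℚ) q +
    (Pi.single k 1 - Pi.single l 1 : ι → ℚ) p * (Pi.single i 1 - Pi.single j 1 : ι → ℚ) q

/-- A symmetric matrix all of whose off-diagonal exchanges vanish is `u i + u j` off the
diagonal. -/
theorem exists_eq_add_of_exchange_eq_zero [Fintype ι] (hι : 3 ≤ Fintype.card ι) {b : ι → ι → ℚ}
    (symm : ∀ i j, b i j = b j i) (diag : ∀ i, b i i = 0)
    (exch : ∀ i j k l, i ≠ j → i ≠ k → i ≠ l → j ≠ k → j ≠ l → k ≠ l →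
      b i k - b j k - b i l + b j l = 0) :
    ∃ u : ι → ℚ, ∀ i j, i ≠ j → b i j = u i + u j := by
  classical
  set m : ℚ := (Fintype.card ι : ℚ) - 2 with hm
  have hm0 : m ≠ 0 := by
    have : (3 : ℚ) ≤ Fintype.card ι := by exact_mod_cast hι
    rw [hm]; linarith
  set r : ι → ℚ := fun i => ∑ k, b i k with hr
  have row : ∀ i j k, i ≠ j → i ≠ k → j ≠ k → r i - r j = m * (b i k - b j k) := by
    intro i j k hij hik hjk
    have key : ∀ l, b i l - b j l =
        (b i k - b j k) + (if l = i then -b i j - (b i k - b j k) else 0) +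
          (if l = j then b i j - (b i k - b j k) else 0) := by
      intro l
      by_cases hli : l = i
      · subst hli; simp [hij, diag, symm j l]
      by_cases hlj : l = j
      · subst hlj; simp [hli, diag]
      by_cases hlk : l = k
      · subst hlk; simp [hli, hlj]
      have := exch i j k l hij hik (Ne.symm hli) hjk (Ne.symm hlj) (Ne.symm hlk)
      simp only [hli, hlj, if_false]; linarith
    calc r i - r j = ∑ l, (b i l - b j l) := by simp [hr]
      _ = _ := by
        rw [Finset.sum_congr rfl fun l _ => key l]
        simp only [Finset.sum_add_distrib, Finset.sum_ite_eq', Finset.mem_univ, if_true,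
          Finset.sum_const, Finset.card_univ, nsmul_eq_mul]
        rw [hm]; ring
  set c : ι → ι → ℚ := fun i k => m * b i k - r i - r k with hc
  have csymm : ∀ i k, c i k = c k i := by intro i k; simp only [hc, symm i k]; ring
  have cstep : ∀ i j k, i ≠ k → j ≠ k → c i k = c j k := by
    intro i j k hik hjk
    by_cases hij : i = j
    · rw [hij]
    · have := row i j k hij hik hjk
      simp only [hc]; linarith
  obtain ⟨p, q, hpq⟩ := Fintype.exists_pair_of_one_lt_card (show 1 < Fintype.card ι by omega)
  have cconst : ∀ i k, i ≠ k → c i k = c p q := by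
    intro i k hik
    by_cases hkp : k = p
    · subst hkp
      rw [cstep i q k hik hpq.symm, csymm]
    · rw [cstep i p k hik (Ne.symm hkp), csymm, cstep k q p hkp hpq.symm, csymm]
  refine ⟨fun i => (r i + c p q / 2) / m, fun i k hik => ?_⟩
  have := cconst i k hik
  simp only [hc] at this ⊢
  field_simp
  linarith

/-- A matrix of the form `u i + u j` off the diagonal is orthogonal to every symmetric hollow
matrix with zero row sums. -/
theorem sum_mul_eq_zero_of_eq_add [Fintype ι] {a b : ι → ι → ℚ} {u : ι → ℚ}
    (symm : ∀ i j, a i j = a j i) (diag : ∀ i, a i i = 0) (row : ∀ i, ∑ j, a i j = 0)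
    (hb : ∀ i j, i ≠ j → b i j = u i + u j) : ∑ i, ∑ j, a i j * b i j = 0 := by
  have h : ∀ i j, a i j * b i j = a i j * u i + a j i * u j := by
    intro i j
    by_cases hij : i = j
    · subst hij; simp [diag]
    · rw [hb i j hij, symm j i]; ring
  simp only [h, Finset.sum_add_distrib]
  rw [Finset.sum_comm (f := fun i j => a j i * u j)]
  simp [← Finset.sum_mul, row]

theorem eq_zero_of_sum_mul_self [Fintype ι] {a : ι → ι → ℚ} (h : ∑ i, ∑ j, a i j * a i j = 0) (i j : ι) :
    a i j = 0 := by
  rw [Finset.sum_eq_zero_iff_of_nonneg fun i _ =>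
    Finset.sum_nonneg fun j _ => mul_self_nonneg _] at h
  have := h i (Finset.mem_univ _)
  rw [Finset.sum_eq_zero_iff_of_nonneg fun j _ => mul_self_nonneg _] at this
  exact mul_self_eq_zero.1 (this j (Finset.mem_univ _))

/-- Antisymmetrizing a symmetric hollow matrix in two disjoint pairs of indices yields a multiple
of an exchange matrix. -/
theorem antisymmetrize_eq_exchangeMatrix [DecidableEq ι] {a : ι → ι → ℚ}
    (symm : ∀ i j, a i j = a j i) (diag : ∀ i, a i i = 0) {i j k l : ι}
    (hij : i ≠ j) (hik : i ≠ k) (hil : i ≠ l) (hjk : j ≠ k) (hjl : j ≠ l) (hkl : k ≠ l)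
    (p q : ι) :
    a p q - a (Equiv.swap i j p) (Equiv.swap i j q) - a (Equiv.swap k l p) (Equiv.swap k l q) +
        a (Equiv.swap k l (Equiv.swap i j p)) (Equiv.swap k l (Equiv.swap i j q)) =
      (a i k - a j k - a i l + a j l) * exchangeMatrix i j k l p q := by
  have cases : ∀ p, p = i ∨ p = j ∨ p = k ∨ p = l ∨ (p ≠ i ∧ p ≠ j ∧ p ≠ k ∧ p ≠ l) := by
    intro p; tauto
  have e1 := hij.symm
  have e2 := hik.symm
  have e3 := hil.symm
  have e4 := hjk.symm
  have e5 := hjl.symm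
  have e6 := hkl.symm
  rcases cases p with rfl | rfl | rfl | rfl | ⟨h1, h2, h3, h4⟩ <;>
  rcases cases q with rfl | rfl | rfl | rfl | ⟨g1, g2, g3, g4⟩ <;>
  simp [exchangeMatrix, Equiv.swap_apply_of_ne_of_ne, *] <;>
  grind

end Combinatorics

theorem List.filterMap_eq_singleton_of_nodup {α β : Type*} {f : α → Option β} {a : α} {b : β}
    (ha : f a = some b) (hf : ∀ x, x ≠ a → f x = none) :
    ∀ {l : List α}, l.Nodup → a ∈ l → l.filterMap f = [b]
  | [], _, h => by simp at h
  | x :: l, hl, h => by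
    rw [List.nodup_cons] at hl
    by_cases hx : x = a
    · subst hx
      have : l.filterMap f = [] := by
        rw [List.filterMap_eq_nil_iff]
        intro y hy
        exact hf y fun e => hl.1 (e ▸ hy)
      simp [ha, this]
    · rw [List.filterMap_cons_none (hf x hx)]
      exact List.filterMap_eq_singleton_of_nodup ha hf hl.2
        ((List.mem_cons.1 h).resolve_left (Ne.symm hx))

theorem List.prod_map_ite_eq_of_nodup {α M : Type*} [DecidableEq α] [Monoid M] (f : α → M)
    (a : α) : ∀ {l : List α}, l.Nodup → (l.map fun x => if x = a then f x else 1).prod =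
      if a ∈ l then f a else 1
  | [], _ => by simp
  | x :: l, hl => by
    rw [List.nodup_cons] at hl
    rw [List.map_cons, List.prod_cons, List.prod_map_ite_eq_of_nodup f a hl.2]
    by_cases hx : x = a
    · subst hx; simp [hl.1]
    · simp [hx, Ne.symm hx]

/-- Linear functionals take arbitrary values on a linearly independent family. -/
theorem LinearIndependent.exists_dual_apply_eq {ι F V : Type*} [Field F] [AddCommGroup V]
    [Module F V] {v : ι → V} (hv : LinearIndependent F v) (c : ι → F) :
    ∃ f : V →ₗ[F] F, ∀ i, f (v i) = c i := by
  obtain ⟨f, hf⟩ := LinearMap.exists_extend ((Module.Basis.span hv).constr F c)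
  refine ⟨f, fun i => ?_⟩
  have := LinearMap.congr_fun hf (Module.Basis.span hv i)
  rw [Module.Basis.constr_basis] at this
  simpa [Module.Basis.span_apply] using this

theorem two_mul_card_fin_lt (n : ℕ) :
    2 * Fintype.card {p : Fin n × Fin n // p.1 < p.2} = n * (n - 1) := by
  have e : {p : Fin n × Fin n // p.1 < p.2} ≃ Σ j : Fin n, Fin (j : ℕ) :=
    { toFun := fun p => ⟨p.1.2, ⟨p.1.1, p.2⟩⟩
      invFun := fun s => ⟨(⟨s.2, s.2.2.trans s.1.2⟩, s.1), s.2.2⟩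
      left_inv := fun p => rfl
      right_inv := fun s => rfl }
  rw [Fintype.card_congr e, Fintype.card_sigma]
  simp only [Fintype.card_fin]
  rw [Fin.sum_univ_eq_sum_range (fun i => i) n, mul_comm, Finset.sum_range_id_mul_two]

namespace KrizCP1

variable {n : ℕ} {E : Type v} [Ring E] [Algebra ℚ E] (K : KrizCP1 n E)

theorem list_prod_w_mem {l : List E} (hl : ∀ x ∈ l, x = 1 ∨ ∃ i, x = K.w i) :
    ∃ m, l.prod ∈ K.comp 0 (2 * m) ∧ (m = 0 → l.prod = 1) := by
  induction l with
  | nil => exact ⟨0, by simpa using K.one_mem, fun _ => rfl⟩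
  | cons x l ih =>
    obtain ⟨m, hm, hm'⟩ := ih fun y hy => hl y (List.mem_cons_of_mem _ hy)
    rw [List.prod_cons]
    rcases hl x List.mem_cons_self with rfl | ⟨i, rfl⟩
    · exact ⟨m, by rwa [one_mul], fun h => by rw [one_mul, hm' h]⟩
    · refine ⟨m + 1, ?_, by omega⟩
      have := K.mul_mem (K.w_mem i) hm
      rwa [zero_add, show 2 + 2 * m = 2 * (m + 1) by ring] at this

theorem list_prod_G_mem {l : List E} (hl : ∀ x ∈ l, ∃ i j, i < j ∧ x = K.G i j) :
    l.prod ∈ K.comp l.length l.length := by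
  induction l with
  | nil => simpa using K.one_mem
  | cons x l ih =>
    obtain ⟨i, j, hij, rfl⟩ := hl x List.mem_cons_self
    have := K.mul_mem (K.G_mem hij.ne) (ih fun y hy => hl y (List.mem_cons_of_mem _ hy))
    rwa [add_comm 1] at this

/-- The exterior generators `G i j` with `i < j`. -/
def generator (p : {p : Fin n × Fin n // p.1 < p.2}) : E := K.G p.1.1 p.1.2

theorem generator_mem (p : {p : Fin n × Fin n // p.1 < p.2}) :
    K.generator p ∈ K.comp 1 1 := K.G_mem p.2.ne

theorem span_generator : Submodule.span ℚ (Set.range K.generator) = K.comp 1 1 := by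
  apply le_antisymm
  · rw [Submodule.span_le]
    rintro _ ⟨p, rfl⟩
    exact K.generator_mem p
  intro x hx
  have top : (⊤ : Submodule ℚ E) ≤ Submodule.span ℚ (Set.range K.generator) ⊔
      ⨆ (qk : ℕ × ℕ) (_ : qk ≠ (1, 1)), K.comp qk.1 qk.2 := by
    rw [← K.span_canon, Submodule.span_le]
    rintro _ ⟨T, e, he, -, rfl⟩
    obtain ⟨m, hm, hm'⟩ := K.list_prod_w_mem (l := List.ofFn fun i => if i ∈ T then K.w i else 1)
      (by
        intro y hy
        obtain ⟨i, rfl⟩ := List.mem_ofFn.1 hy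
        by_cases hi : i ∈ T
        · exact Or.inr ⟨i, by simp [hi]⟩
        · exact Or.inl (by simp [hi]))
    have hG : ∀ y ∈ (List.finRange n).filterMap fun j => (e j).map fun i => K.G i j,
        ∃ i j, i < j ∧ y = K.G i j := by
      intro y hy
      simp only [List.mem_filterMap, Option.map_eq_some_iff] at hy
      obtain ⟨j, -, i, hi, rfl⟩ := hy
      exact ⟨i, j, he j i hi, rfl⟩
    have hprod := K.list_prod_G_mem hG
    unfold krizGprod
    generalize (List.finRange n).filterMap (fun j => (e j).map fun i => K.G i j) = l at *
    generalize (List.ofFn fun i => if i ∈ T then K.w i else 1).prod = t at *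
    by_cases h : (0 + l.length, 2 * m + l.length) = ((1, 1) : ℕ × ℕ)
    · simp only [Prod.mk.injEq] at h
      obtain ⟨y, rfl⟩ := List.length_eq_one_iff.1 (show l.length = 1 by omega)
      obtain ⟨i, j, hij, rfl⟩ := hG y List.mem_cons_self
      rw [hm' (by omega)]
      apply Submodule.mem_sup_left
      exact Submodule.subset_span ⟨⟨(i, j), hij⟩, by simp [generator]⟩
    · apply Submodule.mem_sup_right
      exact Submodule.mem_iSup_of_mem _ (Submodule.mem_iSup_of_mem h (K.mul_mem hm hprod))
  obtain ⟨s, hs, t, ht, rfl⟩ := Submodule.mem_sup.1 (top (Submodule.mem_top (x := x)))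
  have hs' : s ∈ K.comp 1 1 := by
    refine Submodule.span_le.2 ?_ hs
    rintro _ ⟨p, rfl⟩
    exact K.generator_mem p
  have ht' : t ∈ K.comp 1 1 := by simpa using (K.comp 1 1).sub_mem hx hs'
  have disj := K.internal.submodule_iSupIndep (1, 1)
  rw [Submodule.disjoint_def.1 disj t ht' ht, add_zero]
  exact hs

theorem linearIndependent_generator : LinearIndependent ℚ K.generator := by
  classical
  let c : {p : Fin n × Fin n // p.1 < p.2} → {Te : Finset (Fin n) × (Fin n → Option (Fin n)) //
      (∀ j i, Te.2 j = some i → i < j) ∧ (∀ j, Te.2 j ≠ none → j ∉ Te.1)} :=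
    fun p => ⟨(∅, fun j => if j = p.1.2 then some p.1.1 else none), by
      constructor
      · intro j i h
        by_cases hj : j = p.1.2
        · subst hj
          simp only [if_true, Option.some.injEq] at h
          exact h ▸ p.2
        · simp [hj] at h
      · simp⟩
  have hc : Function.Injective c := by
    rintro ⟨⟨i, j⟩, hp⟩ ⟨⟨i', j'⟩, hp'⟩ h
    have h := congrFun (congrArg (fun t => t.1.2) h) j
    by_cases hj : j = j'
    · subst hj
      simpa [c] using h
    · simp [c, hj] at h
  convert K.indep_canon.comp c hc using 1
  funext p
  have : krizGprod K.G (c p).1.2 = K.G p.1.1 p.1.2 := by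
    unfold krizGprod
    rw [List.filterMap_eq_singleton_of_nodup (a := p.1.2) (b := K.G p.1.1 p.1.2) (by simp [c])
      (by intro x hx; simp [c, hx]) (List.nodup_finRange n) (List.mem_finRange _)]
    simp
  simp only [Function.comp_apply]
  rw [this]
  simp [c, generator]

theorem linearIndependent_w : LinearIndependent ℚ K.w := by
  classical
  let c : Fin n → {Te : Finset (Fin n) × (Fin n → Option (Fin n)) //
      (∀ j i, Te.2 j = some i → i < j) ∧ (∀ j, Te.2 j ≠ none → j ∉ Te.1)} :=
    fun i => ⟨({i}, fun _ => none), by simp⟩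
  have hc : Function.Injective c := by
    intro i j h
    simpa [c] using h
  convert K.indep_canon.comp c hc using 1
  funext i
  have hG : krizGprod K.G (c i).1.2 = 1 := by simp [krizGprod, c]
  simp only [Function.comp_apply]
  rw [hG, mul_one, List.ofFn_eq_map]
  have := List.prod_map_ite_eq_of_nodup K.w i (List.nodup_finRange n)
  simp only [List.mem_finRange, if_true] at this
  simpa [c] using this.symm

/-- The combination of the classes `G i j` with a matrix of coefficients. -/
def combination (a : Fin n → Fin n → ℚ) : E := ∑ i, ∑ j, a i j • K.G i j

theorem exists_dual_G {b : Fin n → Fin n → ℚ} (symm : ∀ i j, b i j = b j i) :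
    ∃ f : E →ₗ[ℚ] ℚ, ∀ i j, i ≠ j → f (K.G i j) = b i j := by
  obtain ⟨f, hf⟩ := K.linearIndependent_generator.exists_dual_apply_eq fun p => b p.1.1 p.1.2
  refine ⟨f, fun i j hij => ?_⟩
  rcases lt_or_gt_of_ne hij with h | h
  · exact hf ⟨(i, j), h⟩
  · rw [K.G_symm, symm]
    exact hf ⟨(j, i), h⟩

theorem dual_combination {a b : Fin n → Fin n → ℚ} (diag : ∀ i, a i i = 0) {f : E →ₗ[ℚ] ℚ}
    (hf : ∀ i j, i ≠ j → f (K.G i j) = b i j) :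
    f (K.combination a) = ∑ i, ∑ j, a i j * b i j := by
  simp only [combination, map_sum, map_smul, smul_eq_mul]
  refine Finset.sum_congr rfl fun i _ => Finset.sum_congr rfl fun j _ => ?_
  by_cases hij : i = j
  · subst hij; simp [diag]
  · rw [hf i j hij]

theorem combination_mem {a : Fin n → Fin n → ℚ} (diag : ∀ i, a i i = 0) :
    K.combination a ∈ K.comp 1 1 := by
  refine Submodule.sum_mem _ fun i _ => Submodule.sum_mem _ fun j _ => ?_
  by_cases hij : i = j
  · subst hij; simp [diag]
  · exact Submodule.smul_mem _ _ (K.G_mem hij)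

theorem exists_eq_combination {x : E} (hx : x ∈ K.comp 1 1) :
    ∃ a : Fin n → Fin n → ℚ, (∀ i j, a i j = a j i) ∧ (∀ i, a i i = 0) ∧
      x = K.combination a := by
  rw [← K.span_generator] at hx
  induction hx using Submodule.span_induction with
  | mem x h =>
    obtain ⟨⟨⟨p, q⟩, hpq⟩, rfl⟩ := h
    have hpq : p ≠ q := ne_of_lt hpq
    refine ⟨fun i j => (if i = p then if j = q then (1 / 2 : ℚ) else 0 else 0) +
      (if i = q then if j = p then (1 / 2 : ℚ) else 0 else 0), ?_, ?_, ?_⟩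
    · intro i j
      dsimp only
      split_ifs <;> simp_all
    · intro i
      dsimp only
      split_ifs <;> simp_all
    · simp only [combination, add_smul, Finset.sum_add_distrib, ite_smul, zero_smul]
      simp only [Finset.sum_ite_irrel, Finset.sum_const_zero, Finset.sum_ite_eq',
        Finset.mem_univ, if_true, K.G_symm q p, ← add_smul]
      norm_num [generator]
  | zero => exact ⟨0, by simp, by simp, by simp [combination]⟩
  | add x y _ _ hx hy =>
    obtain ⟨a, ha, ha', rfl⟩ := hx
    obtain ⟨b, hb, hb', rfl⟩ := hy
    refine ⟨a + b, ?_, ?_, ?_⟩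
    · intro i j; simp [ha i j, hb i j]
    · intro i; simp [ha', hb']
    · simp [combination, add_smul, Finset.sum_add_distrib]
  | smul c x _ hx =>
    obtain ⟨a, ha, ha', rfl⟩ := hx
    refine ⟨c • a, ?_, ?_, ?_⟩
    · intro i j; simp [ha i j]
    · intro i; simp [ha']
    · simp [combination, Finset.smul_sum, mul_smul]

theorem d_combination {a : Fin n → Fin n → ℚ} (symm : ∀ i j, a i j = a j i)
    (diag : ∀ i, a i i = 0) :
    K.d (K.combination a) = ∑ i, (2 * ∑ j, a i j) • K.w i := by
  have h : ∀ i j, K.d (a i j • K.G i j) = a i j • K.w i + a j i • K.w j := by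
    intro i j
    by_cases hij : i = j
    · subst hij; simp [diag]
    · rw [map_smul, K.d_G hij, smul_add, symm j i]
  simp only [combination, map_sum, h, Finset.sum_add_distrib]
  rw [Finset.sum_comm (f := fun i j => a j i • K.w j), ← Finset.sum_add_distrib]
  refine Finset.sum_congr rfl fun i _ => ?_
  rw [← Finset.sum_smul, ← two_smul ℚ, smul_smul]

/-- The cocycles of bidegree `(1, 1)` are the symmetric hollow matrices with zero row sums. -/
theorem mem_kernel_iff {x : E} : x ∈ K.comp 1 1 ⊓ LinearMap.ker K.d ↔
    ∃ a : Fin n → Fin n → ℚ, (∀ i j, a i j = a j i) ∧ (∀ i, a i i = 0) ∧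
      (∀ i, ∑ j, a i j = 0) ∧ x = K.combination a := by
  constructor
  · rintro ⟨hx, hd⟩
    obtain ⟨a, symm, diag, rfl⟩ := K.exists_eq_combination hx
    refine ⟨a, symm, diag, fun i => ?_, rfl⟩
    rw [SetLike.mem_coe, LinearMap.mem_ker, K.d_combination symm diag] at hd
    simpa using Fintype.linearIndependent_iff.1 K.linearIndependent_w _ hd i
  · rintro ⟨a, symm, diag, row, rfl⟩
    refine ⟨K.combination_mem diag, ?_⟩
    rw [SetLike.mem_coe, LinearMap.mem_ker, K.d_combination symm diag]
    simp [row]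

theorem act_combination (σ : Equiv.Perm (Fin n)) (a : Fin n → Fin n → ℚ) :
    K.act σ (K.combination a) = K.combination fun i j => a (σ⁻¹ i) (σ⁻¹ j) := by
  simp only [combination, map_sum, map_smul, K.act_G]
  rw [← Equiv.sum_comp σ fun i => ∑ j, a (σ⁻¹ i) (σ⁻¹ j) • K.G i j]
  refine Finset.sum_congr rfl fun i _ => ?_
  rw [← Equiv.sum_comp σ (fun j => a (σ⁻¹ (σ i)) (σ⁻¹ j) • K.G (σ i) j)]
  simp

theorem act_mem_kernel (σ : Equiv.Perm (Fin n)) {x : E}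
    (hx : x ∈ K.comp 1 1 ⊓ LinearMap.ker K.d) :
    K.act σ x ∈ K.comp 1 1 ⊓ LinearMap.ker K.d := by
  obtain ⟨a, symm, diag, row, rfl⟩ := K.mem_kernel_iff.1 hx
  refine K.mem_kernel_iff.2 ⟨_, fun i j => symm _ _, fun i => diag _, fun i => ?_,
    K.act_combination σ a⟩
  rw [Equiv.sum_comp σ⁻¹ fun j => a (σ⁻¹ i) j]
  exact row _

theorem kernel_eq_zero (hn : n = 2 ∨ n = 3) {x : E}
    (hx : x ∈ K.comp 1 1 ⊓ LinearMap.ker K.d) : x = 0 := by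
  obtain ⟨a, symm, diag, row, rfl⟩ := K.mem_kernel_iff.1 hx
  suffices a = 0 by simp [combination, this]
  rcases hn with rfl | rfl
  · have h0 := row 0
    simp only [Fin.sum_univ_two, diag, zero_add] at h0
    have h1 := symm 0 1
    funext i j
    fin_cases i <;> fin_cases j <;> simp [diag] <;> linarith
  · have h0 := row 0
    have h1 := row 1
    have h2 := row 2
    simp only [Fin.sum_univ_three, diag, zero_add] at h0 h1 h2
    have g1 := symm 0 1
    have g2 := symm 0 2
    have g3 := symm 1 2
    funext i j
    fin_cases i <;> fin_cases j <;> simp [diag] <;> linarith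

theorem map_d_comp_one_one (hn : 3 ≤ n) :
    (K.comp 1 1).map K.d = Submodule.span ℚ (Set.range K.w) := by
  apply le_antisymm
  · rintro _ ⟨x, hx, rfl⟩
    obtain ⟨a, symm, diag, rfl⟩ := K.exists_eq_combination hx
    rw [K.d_combination symm diag]
    exact Submodule.sum_mem _ fun i _ =>
      Submodule.smul_mem _ _ (Submodule.subset_span ⟨i, rfl⟩)
  · rw [Submodule.span_le]
    rintro _ ⟨i, rfl⟩
    obtain ⟨j, hj⟩ : ∃ j, j ∉ ({i} : Finset (Fin n)) := by
      refine Finset.exists_mem_notMem_of_card_lt_card (t := Finset.univ) ?_ |>.imp fun _ h => h.2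
      simp; omega
    obtain ⟨k, hk⟩ : ∃ k, k ∉ ({i, j} : Finset (Fin n)) := by
      refine Finset.exists_mem_notMem_of_card_lt_card (t := Finset.univ) ?_ |>.imp fun _ h => h.2
      exact lt_of_le_of_lt Finset.card_le_two (by simp; omega)
    simp only [Finset.mem_singleton, Finset.mem_insert, not_or] at hj hk
    refine ⟨(1 / 2 : ℚ) • (K.G i j + K.G i k - K.G j k), ?_, ?_⟩
    · exact Submodule.smul_mem _ _ (Submodule.sub_mem _ (Submodule.add_mem _
        (K.G_mem (Ne.symm hj)) (K.G_mem (Ne.symm hk.1))) (K.G_mem (Ne.symm hk.2)))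
    · rw [map_smul, map_sub, map_add, K.d_G (Ne.symm hj), K.d_G (Ne.symm hk.1),
        K.d_G (Ne.symm hk.2)]
      module

theorem finrank_kernel (hn : 3 ≤ n) :
    Module.finrank ℚ (K.comp 1 1 ⊓ LinearMap.ker K.d : Submodule ℚ E) = n * (n - 3) / 2 := by
  have hcomp : Module.finrank ℚ (K.comp 1 1) =
      Fintype.card {p : Fin n × Fin n // p.1 < p.2} := by
    rw [← K.span_generator, finrank_span_eq_card K.linearIndependent_generator]
  have : FiniteDimensional ℚ (K.comp 1 1) := by
    rw [← K.span_generator]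
    exact FiniteDimensional.span_of_finite ℚ (Set.finite_range _)
  have rn := (K.d.domRestrict (K.comp 1 1)).finrank_range_add_finrank_ker
  have hrange : LinearMap.range (K.d.domRestrict (K.comp 1 1)) = (K.comp 1 1).map K.d := by
    rw [LinearMap.domRestrict, LinearMap.range_comp, Submodule.range_subtype]
  have hker : Module.finrank ℚ (LinearMap.ker (K.d.domRestrict (K.comp 1 1))) =
      Module.finrank ℚ (K.comp 1 1 ⊓ LinearMap.ker K.d : Submodule ℚ E) := by
    rw [LinearMap.domRestrict, LinearMap.ker_comp, ← Submodule.map_comap_subtype,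
      Submodule.finrank_map_subtype_eq]
  rw [hrange, K.map_d_comp_one_one hn, finrank_span_eq_card K.linearIndependent_w, hker, hcomp,
    Fintype.card_fin] at rn
  have card := two_mul_card_fin_lt n
  obtain ⟨m, rfl⟩ := Nat.exists_eq_add_of_le hn
  have e1 : 3 + m - 1 = m + 2 := by omega
  have e2 : 3 + m - 3 = m := by omega
  rw [e1] at card
  rw [e2]
  symm
  apply Nat.div_eq_of_eq_mul_left two_pos
  nlinarith

theorem kernel_le_of_invariant (hn : 4 ≤ n) {U : Submodule ℚ E}
    (hU : U ≤ K.comp 1 1 ⊓ LinearMap.ker K.d)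
    (inv : ∀ σ : Equiv.Perm (Fin n), ∀ x ∈ U, K.act σ x ∈ U) (hne : U ≠ ⊥) :
    K.comp 1 1 ⊓ LinearMap.ker K.d ≤ U := by
  have hcard : 3 ≤ Fintype.card (Fin n) := by simp; omega
  -- some exchange combination lies in `U`
  obtain ⟨i, j, k, l, hij, hik, hil, hjk, hjl, hkl, hQ⟩ : ∃ i j k l : Fin n, i ≠ j ∧ i ≠ k ∧
      i ≠ l ∧ j ≠ k ∧ j ≠ l ∧ k ≠ l ∧ K.combination (exchangeMatrix i j k l) ∈ U := by
    by_contra! hcon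
    obtain ⟨x, hxU, hx0⟩ := Submodule.exists_mem_ne_zero_of_ne_bot hne
    obtain ⟨a, symm, diag, row, rfl⟩ := K.mem_kernel_iff.1 (hU hxU)
    obtain ⟨u, hu⟩ := exists_eq_add_of_exchange_eq_zero hcard symm diag (by
      intro i j k l hij hik hil hjk hjl hkl
      by_contra hc
      refine hcon i j k l hij hik hil hjk hjl hkl ?_
      have mem := U.add_mem (U.sub_mem (U.sub_mem hxU (inv (Equiv.swap i j) _ hxU))
        (inv (Equiv.swap k l) _ hxU)) (inv (Equiv.swap i j) _ (inv (Equiv.swap k l) _ hxU))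
      simp only [K.act_combination, Equiv.swap_inv] at mem
      rw [← U.smul_mem_iff hc]
      convert mem using 1
      simp only [combination, Finset.smul_sum, ← Finset.sum_sub_distrib,
        ← Finset.sum_add_distrib, ← sub_smul, ← add_smul, smul_smul]
      refine Finset.sum_congr rfl fun p _ => Finset.sum_congr rfl fun q _ => ?_
      rw [antisymmetrize_eq_exchangeMatrix symm diag hij hik hil hjk hjl hkl])
    apply hx0
    have := eq_zero_of_sum_mul_self (sum_mul_eq_zero_of_eq_add symm diag row hu)
    simp [combination, this]
  -- hence all of them do
  have all : ∀ i' j' k' l' : Fin n, i' ≠ j' → i' ≠ k' → i' ≠ l' → j' ≠ k' → j' ≠ l' → k' ≠ l' →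
      K.combination (exchangeMatrix i' j' k' l') ∈ U := by
    intro i' j' k' l' h1 h2 h3 h4 h5 h6
    obtain ⟨σ, hσ⟩ := Equiv.Perm.exists_extending_pair ![i, j, k, l] ![i', j', k', l']
      (by intro p q; fin_cases p <;> fin_cases q <;> simp_all [eq_comm])
      (by intro p q; fin_cases p <;> fin_cases q <;> simp_all [eq_comm])
    have s0 : σ i = i' := hσ 0
    have s1 : σ j = j' := hσ 1
    have s2 : σ k = k' := hσ 2
    have s3 : σ l = l' := hσ 3
    have := inv σ _ hQ
    rw [K.act_combination] at this
    convert this using 2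
    funext p q
    simp only [exchangeMatrix, Pi.sub_apply, Pi.single_apply, Equiv.Perm.inv_eq_iff_eq,
      s0, s1, s2, s3]
  intro x hx
  by_contra hxU
  obtain ⟨f, hfx, hf⟩ := Submodule.exists_le_ker_of_notMem hxU
  obtain ⟨a, symm, diag, row, rfl⟩ := K.mem_kernel_iff.1 hx
  let b : Fin n → Fin n → ℚ := fun i j => if i = j then 0 else f (K.G i j)
  have hb : ∀ i j, i ≠ j → f (K.G i j) = b i j := fun i j h => by simp [b, h]
  have bsymm : ∀ i j, b i j = b j i := fun i j => by simp [b, eq_comm, K.G_symm i j]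
  obtain ⟨u, hu⟩ := exists_eq_add_of_exchange_eq_zero hcard bsymm (fun i => by simp [b]) (by
    intro i j k l hij hik hil hjk hjl hkl
    have h := LinearMap.mem_ker.1 (hf (all i j k l hij hik hil hjk hjl hkl))
    rw [K.dual_combination (b := b) _ hb] at h
    · simp only [exchangeMatrix, Pi.sub_apply, Pi.single_apply, add_mul, sub_mul, mul_sub,
        ite_mul, mul_ite, one_mul, mul_one, zero_mul, mul_zero, Finset.sum_add_distrib,
        Finset.sum_sub_distrib, Finset.sum_ite_eq', Finset.mem_univ, if_true] at h
      linarith [bsymm i k, bsymm j k, bsymm i l, bsymm j l]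
    · intro p
      simp only [exchangeMatrix, Pi.sub_apply, Pi.single_apply]
      grind)
  apply hfx
  rw [K.dual_combination diag hb]
  exact sum_mul_eq_zero_of_eq_add symm diag row hu

end KrizCP1

/-- For the Križ model of `ℂP¹`, the differential `d : E_1^1(ℂP¹,n) → E_0^2(ℂP¹,n)` is
injective for `n = 2` and `n = 3`, while for `n ≥ 4` its kernel `H_1^1` is nonzero of
dimension `n(n-3)/2`: it is an irreducible `S_n`-module (namely `V(n-2,2)`). -/
theorem cp1_first_differential_kernel (n : ℕ)
    (E : Type v) [Ring E] [Algebra ℚ E] (K : KrizCP1 n E) :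
    ((n = 2 ∨ n = 3) → ∀ x ∈ K.comp 1 1, K.d x = 0 → x = 0) ∧
    (4 ≤ n →
      (Module.finrank ℚ (K.comp 1 1 ⊓ LinearMap.ker K.d : Submodule ℚ E) =
          n * (n - 3) / 2 ∧
        (K.comp 1 1 ⊓ LinearMap.ker K.d : Submodule ℚ E) ≠ ⊥ ∧
        -- the kernel is an `S_n`-submodule …
        (∀ σ : Equiv.Perm (Fin n), ∀ x ∈ K.comp 1 1 ⊓ LinearMap.ker K.d,
          K.act σ x ∈ K.comp 1 1 ⊓ LinearMap.ker K.d) ∧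
        -- … and it is irreducible (it is `V(n-2,2)`)
        (∀ U : Submodule ℚ E, U ≤ K.comp 1 1 ⊓ LinearMap.ker K.d →
          (∀ σ : Equiv.Perm (Fin n), ∀ x ∈ U, K.act σ x ∈ U) →
          U = ⊥ ∨ U = K.comp 1 1 ⊓ LinearMap.ker K.d))) := by

  refine ⟨fun hn x hx hd => K.kernel_eq_zero hn ⟨hx, hd⟩, fun hn => ⟨K.finrank_kernel (by omega),
    ?_, fun σ x hx => K.act_mem_kernel σ hx, fun U hU inv => ?_⟩⟩
  · intro h
    have hd := K.finrank_kernel (show 3 ≤ n by omega)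
    rw [h, finrank_bot] at hd
    have : 4 * 1 ≤ n * (n - 3) := Nat.mul_le_mul hn (by omega)
    omega
  · by_cases h : U = ⊥
    · exact Or.inl h
    · exact Or.inr (le_antisymm hU (K.kernel_le_of_invariant hn hU inv h))
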